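/- arXiv:1008.0769 — 2 statements merged into one kernel-verified Lean document; each statement's English description precedes it below -/
import Mathlib

section
/- Let Φ be a homogeneous Poisson process of intensity 1 on R^d, let u > 0 and integer ℓ ≥ 1, and let E be the event that there exist distinct points x_1,...,x_ℓ of Φ with u ≥ |x_1| ≥ |x_2−x_1| ≥ ... ≥ |x_ℓ − x_{ℓ−1}|. Then P(E) ≤ (b_d u^d)^ℓ / ℓ!. -/
open Metric MeasureTheory

/-- `b_d`, the volume of the unit ball in `ℝ^d`. -/
noncomputable def bd (d : ℕ) : ℝ :=
  (volume (closedBall (0 : EuclideanSpace ℝ (Fin d)) 1)).toReal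

/-- `Φ` is a unit-intensity (homogeneous) Poisson point process on `ℝ^d` under `P`:
realizations are locally finite, and for any finite family of pairwise disjoint
measurable sets of finite volume, the point counts are independent Poisson random
variables whose means are the volumes of the sets. -/
def IsPoissonPP {d : ℕ} {Ω : Type*} [MeasurableSpace Ω]
    (P : Measure Ω) (Φ : Ω → Set (EuclideanSpace ℝ (Fin d))) : Prop :=
  (∀ ω, ∀ K : Set (EuclideanSpace ℝ (Fin d)), IsCompact K → (Φ ω ∩ K).Finite) ∧
  ∀ (m : ℕ) (A : Fin m → Set (EuclideanSpace ℝ (Fin d))),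
    (∀ i, MeasurableSet (A i)) → (∀ i, volume (A i) < ⊤) →
    (Pairwise fun i j => Disjoint (A i) (A j)) →
    ∀ k : Fin m → ℕ,
      P {ω | ∀ i, (Φ ω ∩ A i).ncard = k i} =
        ∏ i, ENNReal.ofReal (Real.exp (-(volume (A i)).toReal) *
          (volume (A i)).toReal ^ (k i) / (Nat.factorial (k i)))

/-- The `i`-th increment of the chain `0, x_0, x_1, …`. -/
noncomputable def chainStep {d ℓ : ℕ} (x : Fin ℓ → EuclideanSpace ℝ (Fin d)) (i : Fin ℓ) : ℝ :=
  if i.val = 0 then ‖x i‖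
  else dist (x i) (x ⟨i.val - 1, lt_of_le_of_lt (Nat.sub_le _ _) i.isLt⟩)

/-- The condition `u ≥ |x_1| ≥ |x_2 - x_1| ≥ … ≥ |x_ℓ - x_{ℓ-1}|`. -/
def chainCond {d ℓ : ℕ} (u : ℝ) (x : Fin ℓ → EuclideanSpace ℝ (Fin d)) : Prop :=
  Antitone (chainStep x) ∧ ∀ i, chainStep x i ≤ u

open ProbabilityTheory Set Filter Topology

lemma poisson_weight_shift_le (v : ℝ) (hv : 0 ≤ v) (n k : ℕ) :
    ENNReal.ofReal (Real.exp (-v) * v ^ (n + k) / (Nat.factorial (n + k))) ≤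
      ENNReal.ofReal v ^ n * poissonMeasure v.toNNReal {k} := by
  rw [poissonMeasure_singleton, ← ENNReal.ofReal_pow hv, ← ENNReal.ofReal_mul (by positivity)]
  apply ENNReal.ofReal_le_ofReal
  rw [Real.coe_toNNReal v hv]
  have h : (Nat.factorial k : ℝ) ≤ Nat.factorial (n + k) := by
    exact_mod_cast Nat.factorial_le (Nat.le_add_left k n)
  calc Real.exp (-v) * v ^ (n + k) / (Nat.factorial (n + k))
      ≤ Real.exp (-v) * v ^ (n + k) / (Nat.factorial k) := by gcongr
    _ = _ := by rw [pow_add]; ring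

/-- The first-order tail bound `P(N(A_i) ≥ n_i for all i) ≤ ∏ |A_i| ^ n_i`. -/
lemma IsPoissonPP.measure_le_ncard_le {d : ℕ} {Ω : Type*} [MeasurableSpace Ω] {P : Measure Ω}
    {Φ : Ω → Set (EuclideanSpace ℝ (Fin d))} (hΦ : IsPoissonPP P Φ) {m : ℕ}
    (A : Fin m → Set (EuclideanSpace ℝ (Fin d))) (hA : ∀ i, MeasurableSet (A i))
    (hfin : ∀ i, volume (A i) < ⊤) (hdisj : Pairwise fun i j => Disjoint (A i) (A j))
    (n : Fin m → ℕ) :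
    P {ω | ∀ i, n i ≤ (Φ ω ∩ A i).ncard} ≤ ∏ i, volume (A i) ^ n i := by
  set v : Fin m → ℝ := fun i => (volume (A i)).toReal
  have hsub : {ω | ∀ i, n i ≤ (Φ ω ∩ A i).ncard} ⊆
      ⋃ k : Fin m → ℕ, {ω | ∀ i, (Φ ω ∩ A i).ncard = n i + k i} := by
    intro ω hω
    exact mem_iUnion.2 ⟨fun i => (Φ ω ∩ A i).ncard - n i,
      fun i => (Nat.add_sub_of_le (hω i)).symm⟩
  calc P {ω | ∀ i, n i ≤ (Φ ω ∩ A i).ncard}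
      ≤ ∑' k : Fin m → ℕ, P {ω | ∀ i, (Φ ω ∩ A i).ncard = n i + k i} :=
        (measure_mono hsub).trans (measure_iUnion_le _)
    _ ≤ ∑' k : Fin m → ℕ, (∏ i, volume (A i) ^ n i) *
          Measure.pi (fun i => poissonMeasure (v i).toNNReal) {k} := by
        refine ENNReal.tsum_le_tsum fun k => ?_
        rw [hΦ.2 m A hA hfin hdisj (fun i => n i + k i), Measure.pi_singleton,
          ← Finset.prod_mul_distrib]
        refine Finset.prod_le_prod' fun i _ => ?_
        have := poisson_weight_shift_le (v i) ENNReal.toReal_nonneg (n i) (k i)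
        rwa [ENNReal.ofReal_toReal (hfin i).ne] at this
    _ = ∏ i, volume (A i) ^ n i := by
        rw [ENNReal.tsum_mul_left]
        have h := Measure.tsum_indicator_apply_singleton
          (Measure.pi (fun i => poissonMeasure (v i).toNNReal)) univ MeasurableSet.univ
        simp only [indicator_univ, measure_univ] at h
        rw [h, mul_one]

lemma exists_partition_closedBall {E : Type*} [NormedAddCommGroup E] [ProperSpace E]
    [MeasurableSpace E] [BorelSpace E] (R : ℝ) {δ : ℝ} (hδ : 0 < δ) :
    ∃ (m : ℕ) (A : Fin m → Set E), (∀ i, MeasurableSet (A i)) ∧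
      (Pairwise fun i j => Disjoint (A i) (A j)) ∧ ⋃ i, A i = closedBall 0 R ∧
      ∀ i, ∃ c, A i ⊆ closedBall c δ := by
  obtain ⟨t, -, ht, hcov⟩ := (isCompact_closedBall (0 : E) R).finite_cover_balls hδ
  let e := ht.toFinset.equivFin.symm
  let B : Fin ht.toFinset.card → Set E := fun i => closedBall 0 R ∩ ball (e i : E) δ
  refine ⟨_, disjointed B, ?_, disjoint_disjointed B, ?_, fun i => ⟨e i, ?_⟩⟩
  · intro i
    refine disjointedRec (fun s j hs => hs.diff ?_) ?_ <;>
    exact measurableSet_closedBall.inter measurableSet_ball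
  · rw [iUnion_disjointed, ← inter_iUnion, inter_eq_left]
    refine hcov.trans fun x hx => ?_
    simp only [mem_iUnion] at hx ⊢
    obtain ⟨c, hc, hx⟩ := hx
    exact ⟨e.symm ⟨c, ht.mem_toFinset.2 hc⟩, by simpa using hx⟩
  · exact ((disjointed_subset B i).trans inter_subset_right).trans ball_subset_closedBall

/-- Union bound over a fine partition: the probability that `Φ` contains distinct points
forming an element of the compact set `C` is at most the volume of `C`. -/
lemma IsPoissonPP.measure_exists_injective_mem_le {d : ℕ} (hd : 0 < d) {Ω : Type*}
    [MeasurableSpace Ω] {P : Measure Ω}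
    {Φ : Ω → Set (EuclideanSpace ℝ (Fin d))} (hΦ : IsPoissonPP P Φ) {ℓ : ℕ}
    {C : Set (Fin ℓ → EuclideanSpace ℝ (Fin d))} (hC : IsCompact C) :
    P {ω | ∃ x : Fin ℓ → EuclideanSpace ℝ (Fin d),
        Function.Injective x ∧ (∀ i, x i ∈ Φ ω) ∧ x ∈ C} ≤ volume C := by
  classical
  have : Nonempty (Fin d) := ⟨⟨0, hd⟩⟩
  obtain ⟨R, hR⟩ := hC.isBounded.subset_closedBall 0
  have hCR : ∀ x ∈ C, ∀ i, x i ∈ closedBall (0 : EuclideanSpace ℝ (Fin d)) R := by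
    intro x hx i
    have := hR hx
    rw [mem_closedBall_zero_iff] at this ⊢
    exact (norm_le_pi_norm x i).trans this
  set S := {ω | ∃ x : Fin ℓ → EuclideanSpace ℝ (Fin d),
        Function.Injective x ∧ (∀ i, x i ∈ Φ ω) ∧ x ∈ C}
  set V := volume (closedBall (0 : EuclideanSpace ℝ (Fin d)) R)
  have key : ∀ δ > 0, P S ≤ volume (closedBall (0 : EuclideanSpace ℝ (Fin d)) δ) * V +
      volume (cthickening (2 * δ) C) := by
    intro δ hδ
    obtain ⟨m, A, hAm, hAd, hAU, hAc⟩ :=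
      exists_partition_closedBall (E := EuclideanSpace ℝ (Fin d)) R hδ
    have hAsub : ∀ i, A i ⊆ closedBall 0 R := fun i => hAU ▸ subset_iUnion A i
    have hAfin : ∀ i, volume (A i) < ⊤ := fun i =>
      (measure_mono (hAsub i)).trans_lt measure_closedBall_lt_top
    have hfin : ∀ ω i, (Φ ω ∩ A i).Finite := fun ω i =>
      (hΦ.1 ω _ (isCompact_closedBall 0 R)).subset (inter_subset_inter_right _ (hAsub i))
    let J : Finset (Fin ℓ → Fin m) := {j | Function.Injective j ∧ (univ.pi (A ∘ j) ∩ C).Nonempty}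
    have hsub : S ⊆ (⋃ i, {ω | 2 ≤ (Φ ω ∩ A i).ncard}) ∪
        ⋃ j ∈ J, {ω | ∀ i, 1 ≤ (Φ ω ∩ A (j i)).ncard} := by
      rintro ω ⟨x, hinj, hxΦ, hxC⟩
      have hx : ∀ i, ∃ k, x i ∈ A k := fun i => by
        have := hCR x hxC i
        rwa [← hAU, mem_iUnion] at this
      choose j hj using hx
      by_cases hji : Function.Injective j
      · refine Or.inr (mem_iUnion₂.2 ⟨j, ?_, fun i => ?_⟩)
        · exact Finset.mem_filter.2 ⟨Finset.mem_univ _, hji, x, fun i _ => hj i, hxC⟩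
        · exact (ncard_pos (hfin ω _)).2 ⟨x i, hxΦ i, hj i⟩
      · left
        simp only [Function.Injective, not_forall] at hji
        obtain ⟨a, b, hab, hne⟩ := hji
        refine mem_iUnion.2 ⟨j a, ?_⟩
        exact (one_lt_ncard (hfin ω _)).2
          ⟨x a, ⟨hxΦ a, hj a⟩, x b, ⟨hxΦ b, hab ▸ hj b⟩, hinj.ne hne⟩
    have hdouble : P (⋃ i, {ω | 2 ≤ (Φ ω ∩ A i).ncard}) ≤
        volume (closedBall (0 : EuclideanSpace ℝ (Fin d)) δ) * V := by
      calc P (⋃ i, {ω | 2 ≤ (Φ ω ∩ A i).ncard})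
          ≤ ∑ i, P {ω | 2 ≤ (Φ ω ∩ A i).ncard} := measure_iUnion_fintype_le _ _
        _ ≤ ∑ i, volume (closedBall (0 : EuclideanSpace ℝ (Fin d)) δ) * volume (A i) := by
            refine Finset.sum_le_sum fun i _ => ?_
            have h := hΦ.measure_le_ncard_le (fun _ : Fin 1 => A i) (fun _ => hAm i)
              (fun _ => hAfin i) Subsingleton.pairwise (fun _ => 2)
            simp only [forall_const, Finset.prod_const, Finset.card_univ, Fintype.card_fin,
              pow_one] at h
            refine h.trans ?_
            rw [pow_two]
            obtain ⟨c, hc⟩ := hAc i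
            exact mul_le_mul' ((measure_mono hc).trans_eq
              (Measure.addHaar_closedBall_center volume c δ)) le_rfl
        _ = volume (closedBall (0 : EuclideanSpace ℝ (Fin d)) δ) * V := by
            rw [← Finset.mul_sum, ← tsum_fintype (L := .unconditional _),
              ← measure_iUnion hAd hAm, hAU]
    have hsimple : P (⋃ j ∈ J, {ω | ∀ i, 1 ≤ (Φ ω ∩ A (j i)).ncard}) ≤
        volume (cthickening (2 * δ) C) := by
      calc P (⋃ j ∈ J, {ω | ∀ i, 1 ≤ (Φ ω ∩ A (j i)).ncard})
          ≤ ∑ j ∈ J, P {ω | ∀ i, 1 ≤ (Φ ω ∩ A (j i)).ncard} := measure_biUnion_finset_le _ _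
        _ ≤ ∑ j ∈ J, volume (univ.pi (A ∘ j)) := by
            refine Finset.sum_le_sum fun j hj => ?_
            have hji := (Finset.mem_filter.1 hj).2.1
            have h := hΦ.measure_le_ncard_le (fun i => A (j i)) (fun i => hAm _)
              (fun i => hAfin _) (fun a b hab => hAd (hji.ne hab)) (fun _ => 1)
            simpa [volume_pi_pi] using h
        _ = volume (⋃ j ∈ J, univ.pi (A ∘ j)) := by
            refine (measure_biUnion_finset ?_ fun j _ =>
              MeasurableSet.univ_pi fun i => hAm _).symm
            intro j _ j' _ hjj
            obtain ⟨i, hi⟩ := Function.ne_iff.1 hjj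
            exact disjoint_left.2 fun x hx hx' =>
              disjoint_left.1 (hAd hi) (hx i trivial) (hx' i trivial)
        _ ≤ volume (cthickening (2 * δ) C) := by
            refine measure_mono (iUnion₂_subset fun j hj => fun y hy => ?_)
            obtain ⟨x, hx, hxC⟩ := (Finset.mem_filter.1 hj).2.2
            refine mem_cthickening_of_dist_le y x _ _ hxC ?_
            refine (dist_pi_le_iff (by positivity)).2 fun i => ?_
            obtain ⟨c, hc⟩ := hAc (j i)
            have h1 := mem_closedBall.1 (hc (hy i trivial))
            have h2 := mem_closedBall.1 (hc (hx i trivial))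
            linarith [dist_triangle_right (y i) (x i) c]
    exact (measure_mono hsub).trans ((measure_union_le _ _).trans (add_le_add hdouble hsimple))
  have hV : V ≠ ⊤ := measure_closedBall_lt_top.ne
  have lim1 : Tendsto (fun δ : ℝ => volume (closedBall (0 : EuclideanSpace ℝ (Fin d)) δ) * V)
      (𝓝[>] 0) (𝓝 0) := by
    have h := (tendsto_measure_cthickening_of_isCompact (μ := volume)
      (isCompact_singleton (x := (0 : EuclideanSpace ℝ (Fin d))))).mono_left
      (nhdsWithin_le_nhds (s := Ioi 0))
    rw [measure_singleton] at h
    have h' := ENNReal.Tendsto.mul_const h (Or.inr hV)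
    rw [zero_mul] at h'
    refine h'.congr' ?_
    filter_upwards [self_mem_nhdsWithin] with δ hδ
    rw [cthickening_singleton _ (le_of_lt hδ)]
  have lim2 : Tendsto (fun δ : ℝ => volume (cthickening (2 * δ) C)) (𝓝[>] 0)
      (𝓝 (volume C)) := by
    refine (tendsto_measure_cthickening_of_isCompact hC).comp ?_
    have : Tendsto (fun δ : ℝ => 2 * δ) (𝓝 0) (𝓝 (2 * 0)) := tendsto_id.const_mul 2
    rw [mul_zero] at this
    exact this.mono_left nhdsWithin_le_nhds
  have lim := lim1.add lim2
  rw [zero_add] at lim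
  refine ge_of_tendsto lim ?_
  filter_upwards [self_mem_nhdsWithin] with δ hδ using key δ hδ

/-- The chains `z, x_0, x_1, …` starting at `z` with nonincreasing step lengths at most `u`. -/
def chainSet {E : Type*} [PseudoMetricSpace E] (ℓ : ℕ) (z : E) (u : ℝ) : Set (Fin ℓ → E) :=
  {x | (∀ i j, i ≤ j → dist (x j) ((Fin.cons z x : Fin (ℓ + 1) → E) j.castSucc) ≤
      dist (x i) ((Fin.cons z x : Fin (ℓ + 1) → E) i.castSucc)) ∧
    ∀ i, dist (x i) ((Fin.cons z x : Fin (ℓ + 1) → E) i.castSucc) ≤ u}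

lemma isClosed_chainSet {E : Type*} [PseudoMetricSpace E] (ℓ : ℕ) (z : E) (u : ℝ) :
    IsClosed (chainSet ℓ z u) := by
  have hc : ∀ i : Fin ℓ, Continuous fun x : Fin ℓ → E =>
      dist (x i) ((Fin.cons z x : Fin (ℓ + 1) → E) i.castSucc) := fun i =>
    (continuous_apply i).dist
      ((continuous_apply i.castSucc).comp
        (Continuous.finCons (A := fun _ => E) continuous_const continuous_id))
  have h : chainSet ℓ z u =
      (⋂ i : Fin ℓ, ⋂ j : Fin ℓ, ⋂ _ : i ≤ j,
        {x | dist (x j) ((Fin.cons z x : Fin (ℓ + 1) → E) j.castSucc) ≤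
          dist (x i) ((Fin.cons z x : Fin (ℓ + 1) → E) i.castSucc)}) ∩
      ⋂ i : Fin ℓ, {x | dist (x i) ((Fin.cons z x : Fin (ℓ + 1) → E) i.castSucc) ≤ u} := by
    ext x
    simp [chainSet]
  rw [h]
  exact (isClosed_iInter fun i => isClosed_iInter fun j => isClosed_iInter fun _ =>
    isClosed_le (hc j) (hc i)).inter (isClosed_iInter fun i => isClosed_le (hc i) continuous_const)

lemma isCompact_chainSet {E : Type*} [PseudoMetricSpace E] [ProperSpace E] (ℓ : ℕ) (z : E)
    {u : ℝ} (hu : 0 ≤ u) : IsCompact (chainSet ℓ z u) := by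
  have hb : ∀ x ∈ chainSet ℓ z u, ∀ i : Fin (ℓ + 1),
      dist ((Fin.cons z x : Fin (ℓ + 1) → E) i) z ≤ i * u := by
    intro x hx i
    induction i using Fin.induction with
    | zero => simp
    | succ i ih =>
      have h := hx.2 i
      have h' := dist_triangle (x i) ((Fin.cons z x : Fin (ℓ + 1) → E) i.castSucc) z
      simp only [Fin.cons_succ, Fin.val_succ, Fin.val_castSucc] at ih ⊢
      push_cast
      linarith
  refine Metric.isCompact_of_isClosed_isBounded (isClosed_chainSet ℓ z u)
    ((isBounded_closedBall (x := fun _ => z) (r := ℓ * u)).subset fun x hx => ?_)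
  rw [mem_closedBall, dist_pi_le_iff (by positivity)]
  intro i
  have h := hb x hx i.succ
  rw [Fin.cons_succ] at h
  refine h.trans ?_
  gcongr
  exact_mod_cast i.isLt

lemma cons_mem_chainSet {E : Type*} [PseudoMetricSpace E] {ℓ : ℕ} {z a : E} {u : ℝ}
    {y : Fin ℓ → E} (h : (Fin.cons a y : Fin (ℓ + 1) → E) ∈ chainSet (ℓ + 1) z u) :
    dist a z ≤ u ∧ y ∈ chainSet ℓ a (dist a z) := by
  obtain ⟨h1, h2⟩ := h
  refine ⟨by simpa using h2 0, fun i j hij => ?_, fun i => ?_⟩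
  · simpa [← Fin.succ_castSucc] using h1 i.succ j.succ (Fin.succ_le_succ_iff.2 hij)
  · simpa [← Fin.succ_castSucc] using h1 0 i.succ (Fin.zero_le _)

lemma chainCond_imp_mem_chainSet {d ℓ : ℕ} {u : ℝ} {x : Fin ℓ → EuclideanSpace ℝ (Fin d)}
    (h : chainCond u x) : x ∈ chainSet ℓ 0 u := by
  have hs : ∀ i, dist (x i) ((Fin.cons 0 x : Fin (ℓ + 1) → EuclideanSpace ℝ (Fin d)) i.castSucc)
      = chainStep x i := by
    intro i
    obtain ⟨i, hi⟩ := i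
    cases i with
    | zero => simp [chainStep]
    | succ k =>
      have : (⟨k + 1, hi⟩ : Fin ℓ).castSucc = (⟨k, by omega⟩ : Fin ℓ).succ := rfl
      rw [this, Fin.cons_succ]
      simp [chainStep]
  refine ⟨fun i j hij => ?_, fun i => ?_⟩
  · rw [hs, hs]; exact h.1 hij
  · rw [hs]; exact h.2 i

lemma setLIntegral_closedBall_bd_pow {d : ℕ} (hd : 0 < d) (z : EuclideanSpace ℝ (Fin d)) {u : ℝ}
    (hu : 0 ≤ u) (ℓ : ℕ) :
    ∫⁻ x in closedBall z u, ENNReal.ofReal ((bd d * dist x z ^ d) ^ ℓ / Nat.factorial ℓ) =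
      ENNReal.ofReal ((bd d * u ^ d) ^ (ℓ + 1) / Nat.factorial (ℓ + 1)) := by
  have : Nonempty (Fin d) := ⟨⟨0, hd⟩⟩
  have hb : 0 ≤ bd d := ENNReal.toReal_nonneg
  let g : ℝ → ℝ := fun r => (bd d * r ^ d) ^ ℓ / Nat.factorial ℓ
  have hg : Continuous g := by fun_prop
  have htrans : ∫⁻ x in closedBall z u, ENNReal.ofReal (g (dist x z)) =
      ∫⁻ x in closedBall (0 : EuclideanSpace ℝ (Fin d)) u, ENNReal.ofReal (g ‖x‖) := by
    rw [← lintegral_indicator measurableSet_closedBall,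
      ← lintegral_indicator measurableSet_closedBall,
      ← lintegral_sub_right_eq_self (μ := volume)
        ((closedBall (0 : EuclideanSpace ℝ (Fin d)) u).indicator _) z]
    congr 1 with x
    simp [indicator, dist_eq_norm]
  have hint : ∫ x in closedBall (0 : EuclideanSpace ℝ (Fin d)) u, g ‖x‖ =
      (bd d * u ^ d) ^ (ℓ + 1) / Nat.factorial (ℓ + 1) := by
    calc ∫ x in closedBall (0 : EuclideanSpace ℝ (Fin d)) u, g ‖x‖
        = ∫ x : EuclideanSpace ℝ (Fin d), (Iic u).indicator g ‖x‖ := by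
          rw [← integral_indicator measurableSet_closedBall]
          congr 1 with x
          simp [indicator]
      _ = d * (bd d * ∫ y in Ioi (0 : ℝ), y ^ (d - 1) * (Iic u).indicator g y) := by
          rw [integral_fun_norm_addHaar, nsmul_eq_mul, smul_eq_mul, finrank_euclideanSpace_fin,
            bd, measureReal_def, Measure.addHaar_closedBall_eq_addHaar_ball]
          simp only [smul_eq_mul]
      _ = d * (bd d * ∫ y in (0 : ℝ)..u, y ^ (d - 1) * g y) := by
          rw [intervalIntegral.integral_of_le hu, ← Ioi_inter_Iic,
            ← setIntegral_indicator measurableSet_Iic]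
          simp only [indicator_mul_right]
      _ = d * (bd d * ∫ y in (0 : ℝ)..u,
            (bd d ^ ℓ / Nat.factorial ℓ) * y ^ (d * (ℓ + 1) - 1)) := by
          congr 3 with y
          have : d * (ℓ + 1) - 1 = (d - 1) + d * ℓ := by
            rw [mul_add, mul_one]; omega
          simp only [g]
          rw [this, pow_add, mul_pow, ← pow_mul]
          ring
      _ = _ := by
          rw [intervalIntegral.integral_const_mul, integral_pow]
          have h1 : d * (ℓ + 1) - 1 + 1 = d * (ℓ + 1) :=
            Nat.sub_add_cancel (Nat.mul_pos hd ℓ.succ_pos)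
          have h2 : ((d * (ℓ + 1) - 1 : ℕ) : ℝ) + 1 = d * (ℓ + 1) := by exact_mod_cast h1
          have hd' : (d : ℝ) ≠ 0 := by positivity
          rw [h1, h2, zero_pow (by positivity), Nat.factorial_succ, mul_pow, ← pow_mul]
          push_cast
          field_simp
          ring
  change ∫⁻ x in closedBall z u, ENNReal.ofReal (g (dist x z)) = _
  rw [htrans, ← hint, ofReal_integral_eq_lintegral_ofReal]
  · exact (hg.comp continuous_norm).continuousOn.integrableOn_compact (isCompact_closedBall _ _)
  · exact ae_of_all _ fun x => by
      change 0 ≤ (bd d * ‖x‖ ^ d) ^ ℓ / (Nat.factorial ℓ : ℝ)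
      positivity

lemma volume_chainSet_le {d : ℕ} (hd : 0 < d) (ℓ : ℕ) :
    ∀ (z : EuclideanSpace ℝ (Fin d)) {u : ℝ}, 0 ≤ u →
      volume (chainSet ℓ z u) ≤ ENNReal.ofReal ((bd d * u ^ d) ^ ℓ / Nat.factorial ℓ) := by
  induction ℓ with
  | zero =>
    intro z u _
    refine (measure_mono (subset_univ _)).trans ?_
    rw [volume_pi, Measure.pi_of_empty _ 0]
    simp
  | succ ℓ ih =>
    intro z u hu
    have hmeas : MeasurableSet (chainSet (ℓ + 1) z u) :=
      (isClosed_chainSet (ℓ + 1) z u).measurableSet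
    let e := MeasurableEquiv.piFinSuccAbove (fun _ : Fin (ℓ + 1) => EuclideanSpace ℝ (Fin d)) 0
    have he : MeasurePreserving e.symm volume volume :=
      (volume_preserving_piFinSuccAbove _ 0).symm
    rw [← he.measure_preimage hmeas.nullMeasurableSet, Measure.volume_eq_prod,
      Measure.prod_apply (e.symm.measurable hmeas), ← setLIntegral_closedBall_bd_pow hd z hu,
      ← lintegral_indicator measurableSet_closedBall]
    refine lintegral_mono fun a => ?_
    have hslice : ∀ y, (a, y) ∈ e.symm ⁻¹' chainSet (ℓ + 1) z u →
        dist a z ≤ u ∧ y ∈ chainSet ℓ a (dist a z) := fun y hy =>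
      cons_mem_chainSet (by simpa [e, Fin.insertNthEquiv] using hy)
    by_cases ha : dist a z ≤ u
    · rw [indicator_of_mem (mem_closedBall.2 ha)]
      exact (measure_mono fun y hy => (hslice y hy).2).trans (ih a dist_nonneg)
    · have : Prod.mk a ⁻¹' (e.symm ⁻¹' chainSet (ℓ + 1) z u) = ∅ :=
        eq_empty_of_forall_notMem fun y hy => ha (hslice y hy).1
      rw [this, measure_empty]
      exact zero_le

/-- The probability that the Poisson process `Φ` contains distinct points
`x_1, …, x_ℓ` with `u ≥ |x_1| ≥ |x_2-x_1| ≥ … ≥ |x_ℓ - x_{ℓ-1}|` is at most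
`(b_d u^d)^ℓ / ℓ!`. -/
theorem poisson_chain_bound {d : ℕ} (hd : 0 < d) {Ω : Type*} [MeasurableSpace Ω]
    (P : Measure Ω) [IsProbabilityMeasure P]
    (Φ : Ω → Set (EuclideanSpace ℝ (Fin d))) (hΦ : IsPoissonPP P Φ)
    (u : ℝ) (hu : 0 < u) (ℓ : ℕ) (hℓ : 1 ≤ ℓ) :
    P {ω | ∃ x : Fin ℓ → EuclideanSpace ℝ (Fin d),
        Function.Injective x ∧ (∀ i, x i ∈ Φ ω) ∧ chainCond u x}
      ≤ ENNReal.ofReal ((bd d * u ^ d) ^ ℓ / Nat.factorial ℓ) :=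
  calc P {ω | ∃ x : Fin ℓ → EuclideanSpace ℝ (Fin d),
        Function.Injective x ∧ (∀ i, x i ∈ Φ ω) ∧ chainCond u x}
      ≤ P {ω | ∃ x : Fin ℓ → EuclideanSpace ℝ (Fin d),
        Function.Injective x ∧ (∀ i, x i ∈ Φ ω) ∧ x ∈ chainSet ℓ 0 u} :=
        measure_mono fun _ ⟨x, hinj, hx, hc⟩ => ⟨x, hinj, hx, chainCond_imp_mem_chainSet hc⟩
    _ ≤ volume (chainSet ℓ (0 : EuclideanSpace ℝ (Fin d)) u) :=
        hΦ.measure_exists_injective_mem_le hd (isCompact_chainSet ℓ 0 hu.le)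
    _ ≤ _ := volume_chainSet_le hd ℓ 0 hu.le
end

section
/- There exists a constant c_1 > 0 (depending only on d) such that for the unit-intensity Poisson process Φ on R^d and all t > 0, the probability that either (a) the nearest point of Φ to the origin is at distance greater than (2K)^{-1} t^{1/(d+1)} for K = max(2, (2 b_d e^2)^{1/(d+1)}), or (b) there exists a descending chain 0, x_1, ..., x_ℓ in Φ ∪ {0} with |x_1| ≤ K^{-1} t^{1/(d+1)} and ℓ = ⌊K t^{d/(d+1)}⌋, is at most c_1 exp(−c_1^{-1} t^{d/(d+1)}). -/
open Metric MeasureTheory Real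

open scoped ENNReal Nat

lemma IsCompact.exists_finite_measurable_partition {E : Type*} [PseudoMetricSpace E]
    [MeasurableSpace E] [OpensMeasurableSpace E] {S : Set E} (hS : IsCompact S)
    (hSm : MeasurableSet S) {δ : ℝ} (hδ : 0 < δ) :
    ∃ (n : ℕ) (p : Fin n → E) (Q : Fin n → Set E), (∀ i, MeasurableSet (Q i)) ∧
      (Pairwise fun i j => Disjoint (Q i) (Q j)) ∧ S ⊆ ⋃ i, Q i ∧
      (∀ i, Q i ⊆ S) ∧ ∀ i, Q i ⊆ closedBall (p i) δ := by
  obtain ⟨t, -, htf, hcov⟩ := finite_cover_balls_of_compact hS hδ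
  lift t to Finset E using htf
  let c : Fin t.card → E := fun i => t.equivFin.symm i
  refine ⟨t.card, c, fun i => S ∩ disjointed (fun i => ball (c i) δ) i, fun i => ?_,
    fun i j hij => ?_, fun x hx => ?_, fun i => Set.inter_subset_left, fun i => ?_⟩
  · exact hSm.inter (disjointedRec (fun _ _ ht => ht.diff measurableSet_ball) measurableSet_ball)
  · exact (disjoint_disjointed _ hij).mono Set.inter_subset_right Set.inter_subset_right
  · rw [← Set.inter_iUnion, iUnion_disjointed]
    obtain ⟨y, hy, hxy⟩ := Set.mem_iUnion₂.1 (hcov hx)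
    exact ⟨hx, Set.mem_iUnion.2 ⟨t.equivFin ⟨y, hy⟩, by simpa [c] using hxy⟩⟩
  · exact Set.inter_subset_right.trans ((disjointed_subset _ i).trans ball_subset_closedBall)

section Poisson

variable {d : ℕ} {Ω : Type*} [MeasurableSpace Ω] {P : Measure Ω}
  {Φ : Ω → Set (EuclideanSpace ℝ (Fin d))}

lemma IsPoissonPP.prob_ncard_eq (hΦ : IsPoissonPP P Φ) {A : Set (EuclideanSpace ℝ (Fin d))}
    (hA : MeasurableSet A) (hA' : volume A < ⊤) (k : ℕ) :
    P {ω | (Φ ω ∩ A).ncard = k} = ENNReal.ofReal (exp (-(volume A).toReal) *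
      (volume A).toReal ^ k / k !) := by
  have := hΦ.2 1 (fun _ => A) (fun _ => hA) (fun _ => hA')
    (fun i j hij => (hij (Subsingleton.elim i j)).elim) (fun _ => k)
  simpa using this

lemma IsPoissonPP.prob_two_le_ncard_le (hΦ : IsPoissonPP P Φ)
    {A : Set (EuclideanSpace ℝ (Fin d))} (hA : MeasurableSet A) (hA' : volume A < ⊤) :
    P {ω | 2 ≤ (Φ ω ∩ A).ncard} ≤ volume A ^ 2 := by
  set v := (volume A).toReal with hv
  have hv0 : 0 ≤ v := ENNReal.toReal_nonneg
  have hsum : HasSum (fun k : ℕ => v ^ 2 * exp (-v) * (v ^ k / k !))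
      (v ^ 2 * exp (-v) * exp v) := by
    have := NormedSpace.expSeries_div_hasSum_exp (𝔸 := ℝ) v
    rw [← Real.exp_eq_exp_ℝ] at this
    exact this.mul_left _
  calc P {ω | 2 ≤ (Φ ω ∩ A).ncard}
      ≤ P (⋃ k : ℕ, {ω | (Φ ω ∩ A).ncard = k + 2}) := by
        refine measure_mono fun ω hω => Set.mem_iUnion.2 ⟨(Φ ω ∩ A).ncard - 2, ?_⟩
        exact (Nat.sub_add_cancel hω).symm
    _ ≤ ∑' k : ℕ, P {ω | (Φ ω ∩ A).ncard = k + 2} := measure_iUnion_le _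
    _ ≤ ∑' k : ℕ, ENNReal.ofReal (v ^ 2 * exp (-v) * (v ^ k / k !)) := by
        refine ENNReal.tsum_le_tsum fun k => ?_
        rw [hΦ.prob_ncard_eq hA hA']
        refine ENNReal.ofReal_le_ofReal ?_
        rw [← hv, pow_add, mul_div_assoc, mul_comm (v ^ 2) (exp (-v)), mul_assoc, mul_comm (v ^ k),
          mul_div_assoc]
        gcongr
        omega
    _ = ENNReal.ofReal (v ^ 2) := by
        rw [← ENNReal.ofReal_tsum_of_nonneg (fun k => by positivity) hsum.summable, hsum.tsum_eq,
          mul_assoc, ← exp_add]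
        simp
    _ = volume A ^ 2 := by rw [ENNReal.ofReal_pow hv0, hv, ENNReal.ofReal_toReal hA'.ne]

lemma IsPoissonPP.prob_forall_ncard_eq_one_le (hΦ : IsPoissonPP P Φ) {ι : Type*}
    {Q : ι → Set (EuclideanSpace ℝ (Fin d))} (hQ : ∀ i, MeasurableSet (Q i))
    (hQ' : ∀ i, volume (Q i) < ⊤) (hdisj : Pairwise fun i j => Disjoint (Q i) (Q j))
    (T : Finset ι) :
    P {ω | ∀ a ∈ T, (Φ ω ∩ Q a).ncard = 1} ≤ ∏ a ∈ T, volume (Q a) := by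
  have h := hΦ.2 T.card (fun i => Q (T.equivFin.symm i)) (fun _ => hQ _) (fun _ => hQ' _)
    (fun i j hij => hdisj fun h => hij (T.equivFin.symm.injective (Subtype.ext h))) (fun _ => 1)
  calc P {ω | ∀ a ∈ T, (Φ ω ∩ Q a).ncard = 1}
      ≤ P {ω | ∀ i, (Φ ω ∩ Q (T.equivFin.symm i)).ncard = 1} :=
        measure_mono fun ω hω i => hω _ (T.equivFin.symm i).2
    _ ≤ ∏ i : Fin T.card, volume (Q (T.equivFin.symm i)) := by
        rw [h]
        refine Finset.prod_le_prod' fun i _ => ?_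
        refine (ENNReal.ofReal_le_ofReal ?_).trans_eq (ENNReal.ofReal_toReal (hQ' _).ne)
        have : exp (-(volume (Q (T.equivFin.symm i))).toReal) ≤ 1 := by simp
        simpa using mul_le_of_le_one_left ENNReal.toReal_nonneg this
    _ = ∏ a ∈ T, volume (Q a) := by
        rw [Equiv.prod_comp T.equivFin.symm fun a : T => volume (Q a),
          Finset.prod_coe_sort T fun a => volume (Q a)]

end Poisson

/-- A chain of `k` further cells with centres `p`, starting from the point `q` with a first step of
length at most `ρ`, avoiding the already visited cells `T`, each step being longer than the
preceding one by at most `4 * δ`, such that all visited cells lie in `occ`. -/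
def CellChain {E ι : Type*} [PseudoMetricSpace E] [DecidableEq ι] (p : ι → E) (δ : ℝ)
    (occ : Set ι) : ℕ → E → ℝ → Finset ι → Prop
  | 0, _, _, T => ∀ a ∈ T, a ∈ occ
  | k + 1, q, ρ, T => ∃ a ∉ T, dist (p a) q ≤ ρ ∧
      CellChain p δ occ k (p a) (dist (p a) q + 4 * δ) (insert a T)

lemma CellChain.of_descending {E ι : Type*} [PseudoMetricSpace E] [DecidableEq ι] {p : ι → E}
    {δ : ℝ} {occ : Set ι} (k : ℕ) {x : ℕ → E} {c : ℕ → ι} {q : E} {ρ : ℝ} {T : Finset ι}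
    (hq : dist (x 0) q ≤ δ) (hc : ∀ i < k, dist (x (i + 1)) (p (c i)) ≤ δ)
    (hocc : ∀ i < k, c i ∈ occ) (hinj : ∀ i < k, ∀ j < k, c i = c j → i = j)
    (hT : ∀ i < k, c i ∉ T) (hTocc : ∀ a ∈ T, a ∈ occ)
    (hρ : 0 < k → dist (x 0) (x 1) + 2 * δ ≤ ρ)
    (hdesc : ∀ i, i + 2 ≤ k → dist (x (i + 1)) (x (i + 2)) ≤ dist (x i) (x (i + 1))) :
    CellChain p δ occ k q ρ T := by
  induction k generalizing x c q ρ T with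
  | zero => exact hTocc
  | succ k ih =>
    have h0 := hc 0 k.succ_pos
    have h1 := dist_triangle4 (p (c 0)) (x 1) (x 0) q
    have h2 := dist_triangle4 (x 0) q (p (c 0)) (x 1)
    rw [dist_comm q] at h2
    rw [dist_comm (p (c 0)) (x 1), dist_comm (x 1) (x 0)] at h1
    rw [dist_comm (p (c 0)) (x 1)] at h2
    simp only [zero_add] at h0
    refine ⟨c 0, hT 0 k.succ_pos, by linarith [hρ k.succ_pos], ?_⟩
    refine ih (x := fun i => x (i + 1)) (c := fun i => c (i + 1)) h0
      (fun i hi => hc (i + 1) (by omega)) (fun i hi => hocc (i + 1) (by omega))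
      (fun i hi j hj h => ?_) (fun i hi => ?_) (fun a ha => ?_) (fun hk => ?_)
      (fun i hi => hdesc (i + 1) (by omega))
    · have := hinj (i + 1) (by omega) (j + 1) (by omega) h
      omega
    · rw [Finset.mem_insert, not_or]
      refine ⟨fun h => ?_, hT (i + 1) (by omega)⟩
      have := hinj (i + 1) (by omega) 0 (by omega) h
      omega
    · rcases Finset.mem_insert.1 ha with rfl | ha
      · exact hocc 0 k.succ_pos
      · exact hTocc a ha
    · have := hdesc 0 (by omega)
      simp only [zero_add] at this ⊢
      linarith

lemma bd_eq_real_ball (d : ℕ) :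
    bd d = volume.real (ball (0 : EuclideanSpace ℝ (Fin d)) 1) := by
  rw [bd, Measure.addHaar_unitClosedBall_eq_addHaar_unitBall, Measure.real]

lemma bd_pos (d : ℕ) : 0 < bd d :=
  ENNReal.toReal_pos (measure_closedBall_pos volume _ one_pos).ne' measure_closedBall_lt_top.ne

lemma volume_closedBall_eq_bd {d : ℕ} (q : EuclideanSpace ℝ (Fin d)) {r : ℝ} (hr : 0 ≤ r) :
    volume (closedBall q r) = ENNReal.ofReal (bd d * r ^ d) := by
  rw [Measure.addHaar_closedBall' volume q hr, finrank_euclideanSpace_fin, mul_comm (bd d),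
    ENNReal.ofReal_mul (by positivity), bd, ENNReal.ofReal_toReal measure_closedBall_lt_top.ne]

lemma integral_pow_mul_pow_le {d : ℕ} (hd : 0 < d) {a s b : ℝ} (ha : 0 ≤ a) (hs : 0 ≤ s)
    (hb : 0 ≤ b) (k : ℕ) :
    ∫ y in (0 : ℝ)..s, d * b * (y ^ (d - 1) * ((b * (y + a) ^ d) ^ k / k !)) ≤
      (b * (s + a) ^ d) ^ (k + 1) / (k + 1) ! := by
  have hderiv : ∀ y ∈ Set.uIcc 0 s, HasDerivAt
      (fun y : ℝ => (b * (y + a) ^ d) ^ (k + 1) / (k + 1) !)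
      (d * b * ((y + a) ^ (d - 1) * ((b * (y + a) ^ d) ^ k / k !))) y := fun y _ => by
    have h := ((((hasDerivAt_id' y).add_const a).fun_pow d).const_mul b).fun_pow (k + 1)
    refine (h.div_const ((k + 1) ! : ℝ)).congr_deriv ?_
    simp only [Nat.factorial_succ, Nat.cast_mul, Nat.cast_add, Nat.cast_one,
      Nat.add_sub_cancel]
    field_simp
  calc ∫ y in (0 : ℝ)..s, d * b * (y ^ (d - 1) * ((b * (y + a) ^ d) ^ k / k !))
      ≤ ∫ y in (0 : ℝ)..s, d * b * ((y + a) ^ (d - 1) * ((b * (y + a) ^ d) ^ k / k !)) := by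
        refine intervalIntegral.integral_mono_on hs
          (Continuous.intervalIntegrable (by fun_prop) _ _)
          (Continuous.intervalIntegrable (by fun_prop) _ _) fun y hy => ?_
        have := hy.1
        gcongr
        linarith
    _ = (b * (s + a) ^ d) ^ (k + 1) / ((k + 1) ! : ℕ) -
          (b * (0 + a) ^ d) ^ (k + 1) / ((k + 1) ! : ℕ) :=
        intervalIntegral.integral_eq_sub_of_hasDerivAt hderiv
          (Continuous.intervalIntegrable (by fun_prop) _ _)
    _ ≤ _ := sub_le_self _ (by positivity)

lemma lintegral_closedBall_pow_le {d : ℕ} (hd : 0 < d) (q : EuclideanSpace ℝ (Fin d)) {a s : ℝ}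
    (ha : 0 ≤ a) (hs : 0 ≤ s) (k : ℕ) :
    ∫⁻ y in closedBall q s, ENNReal.ofReal ((bd d * (dist y q + a) ^ d) ^ k / k !) ≤
      ENNReal.ofReal ((bd d * (s + a) ^ d) ^ (k + 1) / (k + 1) !) := by
  have hb := (bd_pos d).le
  have : Nontrivial (EuclideanSpace ℝ (Fin d)) := by
    have : Nonempty (Fin d) := ⟨⟨0, hd⟩⟩
    infer_instance
  set g : ℝ → ℝ := fun y => (bd d * (y + a) ^ d) ^ k / k ! with hg
  have hgc : Continuous g := by fun_prop
  have hint : IntegrableOn (fun y : EuclideanSpace ℝ (Fin d) => g (dist y q))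
      (closedBall q s) :=
    (hgc.comp (continuous_id.dist continuous_const)).continuousOn.integrableOn_compact
      (isCompact_closedBall q s)
  rw [← ofReal_integral_eq_lintegral_ofReal hint (ae_of_all _ fun y => by positivity)]
  refine ENNReal.ofReal_le_ofReal (le_trans (le_of_eq ?_) (integral_pow_mul_pow_le hd ha hs hb k))
  have h1 : ∫ y in closedBall q s, g (dist y q)
      = ∫ y : EuclideanSpace ℝ (Fin d), (Set.Iic s).indicator g ‖y‖ := by
    rw [← integral_indicator measurableSet_closedBall,
      ← integral_sub_right_eq_self (fun y => (Set.Iic s).indicator g ‖y‖) q]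
    refine integral_congr_ae (ae_of_all _ fun y => ?_)
    simp [Set.indicator, dist_eq_norm]
  rw [h1, integral_fun_norm_addHaar, finrank_euclideanSpace_fin, ← bd_eq_real_ball,
    intervalIntegral.integral_of_le hs, integral_const_mul, nsmul_eq_mul, smul_eq_mul, mul_assoc]
  congr 2
  simp_rw [smul_eq_mul]
  rw [show (fun y : ℝ => y ^ (d - 1) * (Set.Iic s).indicator g y)
      = (Set.Iic s).indicator fun y => y ^ (d - 1) * g y by
    ext y
    simp [Set.indicator_mul_right (Set.Iic s) (fun y => y ^ (d - 1)) g],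
    setIntegral_indicator measurableSet_Iic, Set.Ioi_inter_Iic]

lemma sum_volume_mul_pow_le {d : ℕ} (hd : 0 < d) {ι : Type*} (F : Finset ι)
    {p : ι → EuclideanSpace ℝ (Fin d)} {Q : ι → Set (EuclideanSpace ℝ (Fin d))} {δ ρ a : ℝ}
    (hQ : ∀ i, MeasurableSet (Q i))
    (hdisj : Pairwise fun i j => Disjoint (Q i) (Q j)) (hp : ∀ i, Q i ⊆ closedBall (p i) δ)
    (q : EuclideanSpace ℝ (Fin d)) (hF : ∀ i ∈ F, dist (p i) q ≤ ρ) (hδ : 0 ≤ δ) (hρ : 0 ≤ ρ)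
    (ha : 0 ≤ a) (k : ℕ) :
    ∑ i ∈ F, volume (Q i) * ENNReal.ofReal ((bd d * (dist (p i) q + a) ^ d) ^ k / k !) ≤
      ENNReal.ofReal ((bd d * (ρ + a + 2 * δ) ^ d) ^ (k + 1) / (k + 1) !) := by
  have hb := (bd_pos d).le
  calc ∑ i ∈ F, volume (Q i) * ENNReal.ofReal ((bd d * (dist (p i) q + a) ^ d) ^ k / k !)
      ≤ ∑ i ∈ F, ∫⁻ y in Q i,
          ENNReal.ofReal ((bd d * (dist y q + (a + δ)) ^ d) ^ k / k !) := by
        refine Finset.sum_le_sum fun i _ => ?_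
        rw [mul_comm, ← setLIntegral_const]
        refine setLIntegral_mono' (hQ i) fun y hy => ENNReal.ofReal_le_ofReal ?_
        have := dist_triangle (p i) y q
        have := mem_closedBall'.1 (hp i hy)
        have : dist (p i) q + a ≤ dist y q + (a + δ) := by linarith
        gcongr
    _ = ∫⁻ y in ⋃ i ∈ F, Q i,
          ENNReal.ofReal ((bd d * (dist y q + (a + δ)) ^ d) ^ k / k !) :=
        (lintegral_biUnion_finset (fun i _ j _ h => hdisj h) (fun i _ => hQ i) _).symm
    _ ≤ ∫⁻ y in closedBall q (ρ + δ),
          ENNReal.ofReal ((bd d * (dist y q + (a + δ)) ^ d) ^ k / k !) := by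
        refine lintegral_mono_set (Set.iUnion₂_subset fun i hi y hy => ?_)
        have := dist_triangle y (p i) q
        have := mem_closedBall.1 (hp i hy)
        exact mem_closedBall.2 (by linarith [hF i hi])
    _ ≤ _ := by
        refine (lintegral_closedBall_pow_le hd q (by positivity) (by positivity) k).trans_eq ?_
        congr 5
        ring

lemma succ_pow_div_factorial_le_exp (n : ℕ) : ((n : ℝ) + 1) ^ n / n ! ≤ exp (n + 1) := by
  have h := pow_div_factorial_le_exp (x := (n : ℝ) + 1) (by positivity) (n + 1)
  rw [Nat.factorial_succ, pow_succ, Nat.cast_mul, Nat.cast_add, Nat.cast_one,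
    mul_comm ((n : ℝ) + 1) (n ! : ℝ), mul_div_mul_right _ _ (by positivity)] at h
  exact h

lemma pow_floor_div_factorial_le {u v : ℝ} (hv : 0 ≤ v) (h : v ≤ u / (2 * exp 2)) :
    v ^ ⌊u⌋₊ / ⌊u⌋₊ ! ≤ exp 2 * exp (-u) := by
  have hu := Nat.lt_floor_add_one u
  set n := ⌊u⌋₊
  have h1 : v ≤ (n + 1) * exp (-2) := by
    rw [exp_neg]
    refine h.trans ?_
    rw [div_eq_mul_inv]
    gcongr
    linarith [exp_pos 2]
  calc v ^ n / n ! ≤ ((n + 1) * exp (-2)) ^ n / n ! := by gcongr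
    _ = ((n + 1) ^ n / n !) * exp (n * (-2)) := by rw [mul_pow, ← exp_nat_mul]; ring
    _ ≤ exp (n + 1) * exp (n * (-2)) := by gcongr; exact succ_pow_div_factorial_le_exp n
    _ ≤ exp 2 * exp (-u) := by
        rw [← exp_add, ← exp_add]
        exact exp_le_exp.2 (by linarith)

lemma IsPoissonPP.prob_cellChain_le {d : ℕ} (hd : 0 < d) {Ω : Type*} [MeasurableSpace Ω]
    {P : Measure Ω} {Φ : Ω → Set (EuclideanSpace ℝ (Fin d))} (hΦ : IsPoissonPP P Φ)
    {ι : Type*} [Fintype ι] [DecidableEq ι]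
    {p : ι → EuclideanSpace ℝ (Fin d)} {Q : ι → Set (EuclideanSpace ℝ (Fin d))} {δ : ℝ}
    (hδ : 0 ≤ δ) (hQ : ∀ i, MeasurableSet (Q i))
    (hdisj : Pairwise fun i j => Disjoint (Q i) (Q j)) (hp : ∀ i, Q i ⊆ closedBall (p i) δ)
    (k : ℕ) (q : EuclideanSpace ℝ (Fin d)) {ρ : ℝ} (hρ : 0 ≤ ρ) (T : Finset ι) :
    P {ω | CellChain p δ {a | (Φ ω ∩ Q a).ncard = 1} k q ρ T} ≤
      (∏ a ∈ T, volume (Q a)) * ENNReal.ofReal ((bd d * (ρ + 6 * k * δ) ^ d) ^ k / k !) := by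
  induction k generalizing q ρ T with
  | zero =>
    simpa [CellChain] using hΦ.prob_forall_ncard_eq_one_le hQ
      (fun i => (measure_mono (hp i)).trans_lt measure_closedBall_lt_top) hdisj T
  | succ k ih =>
    classical
    set F : Finset ι := {a | a ∉ T ∧ dist (p a) q ≤ ρ} with hF
    have hmem : ∀ a ∈ F, a ∉ T ∧ dist (p a) q ≤ ρ := fun a ha => by simpa [hF] using ha
    calc P {ω | CellChain p δ {a | (Φ ω ∩ Q a).ncard = 1} (k + 1) q ρ T}
        ≤ P (⋃ a ∈ F, {ω | CellChain p δ {a | (Φ ω ∩ Q a).ncard = 1} k (p a)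
            (dist (p a) q + 4 * δ) (insert a T)}) := by
          refine measure_mono fun ω hω => ?_
          obtain ⟨a, haT, haq, h⟩ := hω
          exact Set.mem_iUnion₂.2 ⟨a, by simp [hF, haT, haq], h⟩
      _ ≤ ∑ a ∈ F, P {ω | CellChain p δ {a | (Φ ω ∩ Q a).ncard = 1} k (p a)
            (dist (p a) q + 4 * δ) (insert a T)} := measure_biUnion_finset_le _ _
      _ ≤ ∑ a ∈ F, (∏ a ∈ T, volume (Q a)) * (volume (Q a) *
            ENNReal.ofReal ((bd d * (dist (p a) q + (4 * δ + 6 * k * δ)) ^ d) ^ k / k !)) := by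
          refine Finset.sum_le_sum fun a ha => (ih (p a) (by positivity) _).trans_eq ?_
          rw [Finset.prod_insert (hmem a ha).1, ← mul_assoc, mul_comm (volume (Q a)), add_assoc]
      _ ≤ _ := by
          rw [← Finset.mul_sum]
          gcongr
          refine (sum_volume_mul_pow_le hd F hQ hdisj hp q (fun a ha => (hmem a ha).2) hδ hρ
            (by positivity) k).trans_eq ?_
          congr 5
          push_cast
          ring

/-- There is a descending chain of length `n` from the origin through `S` whose
first step has length at most `r`. -/
def HasDescendingChain {d : ℕ} (S : Set (EuclideanSpace ℝ (Fin d))) (n : ℕ) (r : ℝ) : Prop :=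
  ∃ x : ℕ → EuclideanSpace ℝ (Fin d), x 0 = 0 ∧ (∀ i, 1 ≤ i → i ≤ n → x i ∈ S) ∧
    (∀ i j, i ≤ n → j ≤ n → x i = x j → i = j) ∧ ‖x 1‖ ≤ r ∧
    (∀ i, i + 2 ≤ n → dist (x (i + 1)) (x (i + 2)) ≤ dist (x i) (x (i + 1)))

lemma norm_le_of_descending {E : Type*} [SeminormedAddCommGroup E] {x : ℕ → E} {n : ℕ} {r : ℝ}
    (h0 : x 0 = 0) (h1 : ‖x 1‖ ≤ r)
    (hdesc : ∀ i, i + 2 ≤ n → dist (x (i + 1)) (x (i + 2)) ≤ dist (x i) (x (i + 1)))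
    {i : ℕ} (hi : i ≤ n) : ‖x i‖ ≤ n * r := by
  have hstep : ∀ i < n, dist (x i) (x (i + 1)) ≤ r := fun i => by
    induction i with
    | zero => intro _; simpa [h0] using h1
    | succ i ih => intro hi; exact (hdesc i (by omega)).trans (ih (by omega))
  have hsum : dist (x 0) (x i) ≤ ∑ _j ∈ Finset.range i, r :=
    dist_le_range_sum_of_dist_le i fun hj => hstep _ (by omega)
  have hr : 0 ≤ r := (norm_nonneg _).trans h1
  have hin : (i : ℝ) ≤ n := by exact_mod_cast hi
  rw [h0, dist_zero_left, Finset.sum_const, Finset.card_range, nsmul_eq_mul] at hsum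
  exact hsum.trans (by gcongr)

lemma HasDescendingChain.exists_cell {d : ℕ} {S : Set (EuclideanSpace ℝ (Fin d))}
    {n : ℕ} {r δ : ℝ} (h : HasDescendingChain S n r) (hδ : 0 ≤ δ)
    (hS : ∀ K, IsCompact K → (S ∩ K).Finite) {ι : Type*} [DecidableEq ι]
    {p : ι → EuclideanSpace ℝ (Fin d)} {Q : ι → Set (EuclideanSpace ℝ (Fin d))}
    (hcov : closedBall 0 (n * r) ⊆ ⋃ i, Q i) (hp : ∀ i, Q i ⊆ closedBall (p i) δ) :
    (∃ a, 2 ≤ (S ∩ Q a).ncard) ∨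
      CellChain p δ {a | (S ∩ Q a).ncard = 1} n 0 (r + 2 * δ) ∅ := by
  refine or_iff_not_imp_left.2 fun hno => ?_
  push Not at hno
  obtain ⟨x, h0, hxS, hinj, h1, hdesc⟩ := h
  have hfin : ∀ a, (S ∩ Q a).Finite := fun a =>
    (hS _ (isCompact_closedBall (p a) δ)).subset (Set.inter_subset_inter_right _ (hp a))
  have hcell : ∀ i : ℕ, ∃ a, i < n → x (i + 1) ∈ Q a := fun i => by
    have hne : Nonempty ι := by
      have h0' : (0 : EuclideanSpace ℝ (Fin d)) ∈ closedBall 0 (n * r) := by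
        have : 0 ≤ r := (norm_nonneg _).trans h1
        exact mem_closedBall_self (by positivity)
      obtain ⟨a, -⟩ := Set.mem_iUnion.1 (hcov h0')
      exact ⟨a⟩
    by_cases hi : i < n
    · have : x (i + 1) ∈ closedBall 0 (n * r) := by
        simpa using norm_le_of_descending h0 h1 hdesc (i := i + 1) (by omega)
      obtain ⟨a, ha⟩ := Set.mem_iUnion.1 (hcov this)
      exact ⟨a, fun _ => ha⟩
    · exact ⟨hne.some, fun h => (hi h).elim⟩
  choose c hc using hcell
  have hxc : ∀ i < n, x (i + 1) ∈ S ∩ Q (c i) := fun i hi =>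
    ⟨hxS _ (by omega) (by omega), hc i hi⟩
  refine CellChain.of_descending n (x := x) (c := c) (by simpa [h0] using hδ)
    (fun i hi => hp _ (hc i hi)) (fun i hi => ?_) (fun i hi j hj hij => ?_) (by simp) (by simp)
    (fun _ => by simpa [h0] using h1) hdesc
  · have hpos := (Set.ncard_pos (hfin (c i))).2 ⟨_, hxc i hi⟩
    have := hno (c i)
    rw [Set.mem_ofPred_eq]
    omega
  · have hle : (S ∩ Q (c i)).ncard ≤ 1 := Nat.le_of_lt_succ (hno (c i))
    have := (Set.ncard_le_one (hfin (c i))).1 hle _ (hxc i hi) _ (hij ▸ hxc j hj)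
    have := hinj _ _ (by omega) (by omega) this
    omega

lemma IsPoissonPP.prob_hasDescendingChain_le_add {d : ℕ} (hd : 0 < d) {Ω : Type*}
    [MeasurableSpace Ω] {P : Measure Ω} {Φ : Ω → Set (EuclideanSpace ℝ (Fin d))}
    (hΦ : IsPoissonPP P Φ) (n : ℕ) {r δ : ℝ} (hr : 0 ≤ r) (hδ : 0 < δ) :
    P {ω | HasDescendingChain (Φ ω) n r} ≤
      ENNReal.ofReal (bd d * δ ^ d * (bd d * (n * r) ^ d) +
        (bd d * (r + 2 * δ + 6 * n * δ) ^ d) ^ n / n !) := by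
  have hb := (bd_pos d).le
  have hR : 0 ≤ n * r := by positivity
  obtain ⟨N, p, Q, hQ, hdisj, hcov, hQS, hp⟩ :=
    (isCompact_closedBall (0 : EuclideanSpace ℝ (Fin d)) (n * r)).exists_finite_measurable_partition
      measurableSet_closedBall hδ
  have hvol : ∀ a, volume (Q a) ≤ ENNReal.ofReal (bd d * δ ^ d) := fun a =>
    (measure_mono (hp a)).trans_eq (volume_closedBall_eq_bd _ hδ.le)
  calc P {ω | HasDescendingChain (Φ ω) n r}
      ≤ P ((⋃ a ∈ Finset.univ, {ω | 2 ≤ (Φ ω ∩ Q a).ncard}) ∪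
          {ω | CellChain p δ {a | (Φ ω ∩ Q a).ncard = 1} n 0 (r + 2 * δ) ∅}) := by
        refine measure_mono fun ω hω => ?_
        rcases HasDescendingChain.exists_cell hω hδ.le (hΦ.1 ω) hcov hp with ⟨a, ha⟩ | h
        · exact Or.inl (Set.mem_iUnion₂.2 ⟨a, Finset.mem_univ a, ha⟩)
        · exact Or.inr h
    _ ≤ ∑ a, P {ω | 2 ≤ (Φ ω ∩ Q a).ncard} +
          P {ω | CellChain p δ {a | (Φ ω ∩ Q a).ncard = 1} n 0 (r + 2 * δ) ∅} :=
        (measure_union_le _ _).trans (by gcongr; exact measure_biUnion_finset_le _ _)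
    _ ≤ ∑ a, ENNReal.ofReal (bd d * δ ^ d) * volume (Q a) +
          ENNReal.ofReal ((bd d * (r + 2 * δ + 6 * n * δ) ^ d) ^ n / n !) := by
        gcongr with a
        · refine (hΦ.prob_two_le_ncard_le (hQ a)
            ((hvol a).trans_lt ENNReal.ofReal_lt_top)).trans ?_
          rw [sq]
          gcongr
          exact hvol a
        · simpa using hΦ.prob_cellChain_le hd hδ.le hQ hdisj hp n 0 (ρ := r + 2 * δ)
            (by positivity) ∅
    _ ≤ _ := by
        rw [ENNReal.ofReal_add (by positivity) (by positivity),
          ENNReal.ofReal_mul (p := bd d * δ ^ d) (by positivity), ← Finset.mul_sum,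
          ← volume_closedBall_eq_bd 0 hR]
        gcongr
        rw [← tsum_fintype (L := .unconditional _), ← measure_iUnion hdisj hQ]
        exact measure_mono (Set.iUnion_subset hQS)

lemma IsPoissonPP.prob_hasDescendingChain_le {d : ℕ} (hd : 0 < d) {Ω : Type*}
    [MeasurableSpace Ω] {P : Measure Ω} {Φ : Ω → Set (EuclideanSpace ℝ (Fin d))}
    (hΦ : IsPoissonPP P Φ) (n : ℕ) {r : ℝ} (hr : 0 ≤ r) :
    P {ω | HasDescendingChain (Φ ω) n r} ≤ ENNReal.ofReal ((bd d * r ^ d) ^ n / n !) := by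
  have hcont : Continuous fun δ : ℝ => ENNReal.ofReal (bd d * δ ^ d * (bd d * (n * r) ^ d) +
      (bd d * (r + 2 * δ + 6 * n * δ) ^ d) ^ n / n !) :=
    ENNReal.continuous_ofReal.comp (by fun_prop)
  have hlim := (hcont.tendsto 0).mono_left (nhdsWithin_le_nhds (s := Set.Ioi 0))
  simp only [ne_eq, hd.ne', not_false_eq_true, zero_pow, mul_zero, zero_mul, add_zero,
    zero_add] at hlim
  exact ge_of_tendsto hlim (Filter.eventually_of_mem self_mem_nhdsWithin fun δ hδ =>
    hΦ.prob_hasDescendingChain_le_add hd n hr hδ)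

lemma IsPoissonPP.prob_forall_lt_dist_le {d : ℕ} {Ω : Type*} [MeasurableSpace Ω]
    {P : Measure Ω} {Φ : Ω → Set (EuclideanSpace ℝ (Fin d))} (hΦ : IsPoissonPP P Φ) {r : ℝ}
    (hr : 0 ≤ r) :
    P {ω | ∀ y ∈ Φ ω, r < dist 0 y} ≤ ENNReal.ofReal (exp (-(bd d * r ^ d))) := by
  have hb := (bd_pos d).le
  have h := hΦ.prob_ncard_eq (A := closedBall 0 r) measurableSet_closedBall
    measure_closedBall_lt_top 0
  rw [volume_closedBall_eq_bd 0 hr, ENNReal.toReal_ofReal (by positivity)] at h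
  simp only [pow_zero, Nat.factorial_zero, Nat.cast_one, mul_one, div_one] at h
  rw [← h]
  refine measure_mono fun ω hω => ?_
  have : Φ ω ∩ closedBall 0 r = ∅ := Set.eq_empty_of_forall_notMem fun y hy =>
    (hω y hy.1).not_ge (mem_closedBall'.1 hy.2)
  simp [this]

/-- **Tail bound for nearest-neighbour distance or long descending chains.**
With `K = max(2, (2 b_d e²)^{1/(d+1)})` and `ℓ = ⌊K t^{d/(d+1)}⌋`, the probability that
either (a) the nearest point of `Φ` to the origin is at distance more than
`(2K)⁻¹ t^{1/(d+1)}`, or (b) there is a descending chain `0, x_1, …, x_ℓ` in `Φ ∪ {0}`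
(distinct points of `Φ ∪ {0}` starting at `0` with non-increasing successive distances)
with `|x_1| ≤ K⁻¹ t^{1/(d+1)}`, is at most `c₁ exp(-c₁⁻¹ t^{d/(d+1)})`. -/
theorem descending_chain_tail {d : ℕ} (hd : 0 < d) {Ω : Type*} [MeasurableSpace Ω]
    (P : Measure Ω) [IsProbabilityMeasure P]
    (Φ : Ω → Set (EuclideanSpace ℝ (Fin d))) (hΦ : IsPoissonPP P Φ) :
    ∃ c₁ > (0:ℝ), ∀ t > (0:ℝ),
      P {ω | (∀ y ∈ Φ ω,
                (2 * max 2 ((2 * bd d * exp 2) ^ ((1:ℝ)/(d+1))))⁻¹ * t ^ ((1:ℝ)/(d+1))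
                  < dist (0 : EuclideanSpace ℝ (Fin d)) y) ∨
             (∃ x : ℕ → EuclideanSpace ℝ (Fin d),
                x 0 = 0 ∧
                (∀ i, 1 ≤ i → i ≤ ⌊max 2 ((2 * bd d * exp 2) ^ ((1:ℝ)/(d+1)))
                    * t ^ ((d:ℝ)/(d+1))⌋₊ → x i ∈ Φ ω) ∧
                (∀ i j, i ≤ ⌊max 2 ((2 * bd d * exp 2) ^ ((1:ℝ)/(d+1))) * t ^ ((d:ℝ)/(d+1))⌋₊ →
                  j ≤ ⌊max 2 ((2 * bd d * exp 2) ^ ((1:ℝ)/(d+1))) * t ^ ((d:ℝ)/(d+1))⌋₊ →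
                  x i = x j → i = j) ∧
                ‖x 1‖ ≤ (max 2 ((2 * bd d * exp 2) ^ ((1:ℝ)/(d+1))))⁻¹ * t ^ ((1:ℝ)/(d+1)) ∧
                (∀ i, i + 2 ≤ ⌊max 2 ((2 * bd d * exp 2) ^ ((1:ℝ)/(d+1)))
                    * t ^ ((d:ℝ)/(d+1))⌋₊ →
                  dist (x (i+1)) (x (i+2)) ≤ dist (x i) (x (i+1))))}
        ≤ ENNReal.ofReal (c₁ * exp (-c₁⁻¹ * t ^ ((d:ℝ)/(d+1)))) := by
  have hb := bd_pos d
  set K : ℝ := max 2 ((2 * bd d * exp 2) ^ ((1 : ℝ) / (d + 1))) with hK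
  have hK2 : 2 ≤ K := le_max_left _ _
  have hK0 : 0 < K := by linarith
  have hKpow : 2 * bd d * exp 2 ≤ K ^ (d + 1) := by
    have h : (2 * bd d * exp 2) ^ ((1 : ℝ) / (d + 1)) ≤ K := le_max_right _ _
    calc 2 * bd d * exp 2 = ((2 * bd d * exp 2) ^ ((1 : ℝ) / (d + 1))) ^ (d + 1) := by
          rw [← rpow_natCast, ← rpow_mul (by positivity)]
          push_cast
          rw [one_div_mul_cancel (by positivity), rpow_one]
      _ ≤ K ^ (d + 1) := by gcongr
  set β : ℝ := bd d * (2 * K)⁻¹ ^ d with hβ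
  have hβ0 : 0 < β := by positivity
  refine ⟨1 + exp 2 + β⁻¹, by positivity, fun t ht => ?_⟩
  set s : ℝ := t ^ ((d : ℝ) / (d + 1)) with hs
  have hs0 : 0 < s := rpow_pos_of_pos ht _
  have hts : (t ^ ((1 : ℝ) / (d + 1))) ^ d = s := by
    rw [← rpow_natCast, ← rpow_mul ht.le, one_div_mul_eq_div]
  set c : ℝ := 1 + exp 2 + β⁻¹ with hc
  have hβc : c⁻¹ ≤ β := inv_le_of_inv_le₀ hβ0 (by have := exp_pos 2; linarith)
  have hc1 : c⁻¹ ≤ 1 := inv_le_one_of_one_le₀ (by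
    have := exp_pos 2
    have := inv_pos.2 hβ0
    linarith)
  have hnear := hΦ.prob_forall_lt_dist_le (r := (2 * K)⁻¹ * t ^ ((1 : ℝ) / (d + 1)))
    (by positivity)
  have hchain := hΦ.prob_hasDescendingChain_le hd ⌊K * s⌋₊
    (r := K⁻¹ * t ^ ((1 : ℝ) / (d + 1))) (by positivity)
  rw [mul_pow (_⁻¹), hts] at hnear hchain
  have hv : bd d * (K⁻¹ ^ d * s) ≤ K * s / (2 * exp 2) := by
    rw [inv_pow, le_div_iff₀ (by positivity)]
    calc bd d * ((K ^ d)⁻¹ * s) * (2 * exp 2) = 2 * bd d * exp 2 * ((K ^ d)⁻¹ * s) := by ring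
      _ ≤ K ^ (d + 1) * ((K ^ d)⁻¹ * s) := by gcongr
      _ = K * s := by rw [pow_succ]; field_simp
  have hfact := pow_floor_div_factorial_le (by positivity) hv
  refine (measure_union_le _ _).trans ((add_le_add hnear hchain).trans ?_)
  rw [← ENNReal.ofReal_add (by positivity) (by positivity)]
  refine ENNReal.ofReal_le_ofReal ?_
  have h1 : exp (-(bd d * ((2 * K)⁻¹ ^ d * s))) ≤ exp (-c⁻¹ * s) := by
    rw [← mul_assoc, ← hβ, neg_mul]
    gcongr
  have h2 : exp (-(K * s)) ≤ exp (-c⁻¹ * s) := by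
    rw [neg_mul]
    gcongr
    linarith
  calc _ ≤ exp (-c⁻¹ * s) + exp 2 * exp (-c⁻¹ * s) :=
        add_le_add h1 (hfact.trans (by gcongr))
    _ = (1 + exp 2) * exp (-c⁻¹ * s) := by ring
    _ ≤ c * exp (-c⁻¹ * s) := by
        gcongr
        have := inv_pos.2 hβ0
        linarith
end
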